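/- Liminf inequality for the discrete bending energy along H¹-convergent polygons: Let v : ℝ → ℝ be twice continuously differentiable and 1-periodic. Let Nₙ → ∞ be integers, hₙ = 1/Nₙ, and for each n let vₙ be (the piecewise-affine function of) a discrete curve on the mesh of size hₙ such that ∫₀¹ (vₙ(x) − v(x))² dx → 0 and ∫₀¹ (vₙ'(x) − v'(x))² dx → 0. Then ∫₀¹ v''(x)²/(1 + v'(x)²)^{5/2} dx ≤ liminf_{n→∞} Σ_{j=1}^{Nₙ} θ_j(vₙ)²·(l_j(vₙ)³ + l_{j+1}(vₙ)³)/(l_j(vₙ)·l_{j+1}(vₙ)·(l_j(vₙ) + l_{j+1}(vₙ))²). -/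

import Mathlib

open Filter MeasureTheory

noncomputable section

/-- mesh point `x_j = j·h` with `h = 1/N`. -/
def xj (N : ℕ) (j : ℤ) : ℝ := j * ((1 : ℝ) / N)

/-- first difference quotient `d_j = (v_j − v_{j−1})/h`. -/
def dq (N : ℕ) (v : ℤ → ℝ) (j : ℤ) : ℝ := (v j - v (j - 1)) / ((1 : ℝ) / N)

/-- second difference quotient `D_j = (v_{j+1} − 2v_j + v_{j−1})/h²`. -/
def Dq (N : ℕ) (v : ℤ → ℝ) (j : ℤ) : ℝ :=
  (v (j + 1) - 2 * v j + v (j - 1)) / ((1 : ℝ) / N) ^ 2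

/-- half segment length `l_j = (h/2)·√(1 + d_j²)`. -/
def lq (N : ℕ) (v : ℤ → ℝ) (j : ℤ) : ℝ :=
  ((1 : ℝ) / N) / 2 * Real.sqrt (1 + dq N v j ^ 2)

/-- angle `θ_j` between consecutive segments. -/
def θq (N : ℕ) (v : ℤ → ℝ) (j : ℤ) : ℝ :=
  Real.arccos ((1 + dq N v j * dq N v (j + 1)) /
    (Real.sqrt (1 + dq N v j ^ 2) * Real.sqrt (1 + dq N v (j + 1) ^ 2)))

/-- discrete bending energy `B_h`. -/
def Bh (C : ℝ) (N : ℕ) (v : ℤ → ℝ) : ℝ :=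
  C / 2 * ∑ j ∈ Finset.Icc (1 : ℤ) N, θq N v j ^ 2 *
    ((lq N v j ^ 3 + lq N v (j + 1) ^ 3) /
      (lq N v j * lq N v (j + 1) * (lq N v j + lq N v (j + 1)) ^ 2))

/-- discrete tension `T_h`. -/
def Th (σ : ℝ) (N : ℕ) (v : ℤ → ℝ) : ℝ :=
  σ * ∑ j ∈ Finset.Icc (1 : ℤ) N, 2 * lq N v j

/-- a regularizer `ζ`. -/
def IsRegularizer (ζ : ℝ → ℝ) : Prop :=
  ContDiff ℝ 1 ζ ∧ (∀ t, 0 ≤ ζ t ∧ ζ t ≤ 1) ∧ (∀ t, ζ (-t) = ζ t) ∧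
    (∀ t, 1 < t → ζ t = 0) ∧ AntitoneOn ζ (Set.Icc 0 1) ∧ ζ 0 = 1

/-- discrete adhesion energy `A_{h,δ}` (with `ζ_δ(t) = ζ(t/δ)`). -/
def Ah (γ : ℝ) (ζ : ℝ → ℝ) (δ : ℝ) (ψ : ℝ → ℝ) (N : ℕ) (v : ℤ → ℝ) : ℝ :=
  γ * ∑ j ∈ Finset.Icc (1 : ℤ) N,
    ζ ((v (j - 1) - ψ (xj N (j - 1))) / δ) * ζ ((v j - ψ (xj N j)) / δ) * (2 * lq N v j)

/-- discrete penalty `P_{h,ρ}`. -/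
def Ph (ρ : ℝ) (ψ : ℝ → ℝ) (N : ℕ) (v : ℤ → ℝ) : ℝ :=
  1 / ρ * ∑ j ∈ Finset.Icc (1 : ℤ) N, max (ψ (xj N j) - v j) 0 ^ 2 * ((1 : ℝ) / N)

/-- total discrete energy `E_{h,δ,ρ}`. -/
def Eh (C σ γ : ℝ) (ζ ψ : ℝ → ℝ) (N : ℕ) (δ ρ : ℝ) (v : ℤ → ℝ) : ℝ :=
  Bh C N v + Th σ N v - Ah γ ζ δ ψ N v + Ph ρ ψ N v

/-- piecewise-affine interpolant of a discrete curve: on `[x_{j−1}, x_j]` it is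
`v_{j−1} + d_j·(x − x_{j−1})`. -/
def interp (N : ℕ) (v : ℤ → ℝ) (x : ℝ) : ℝ :=
  v (⌈x * N⌉ - 1) + dq N v ⌈x * N⌉ * (x - xj N (⌈x * N⌉ - 1))

/-- slope step function of a discrete curve: equal to `d_j` on `(x_{j−1}, x_j)`. -/
def slopeFn (N : ℕ) (v : ℤ → ℝ) (x : ℝ) : ℝ := dq N v ⌈x * N⌉

/-- A product of a bounded pointwise convergent sequence with an `L¹`-convergent one converges
in integral. -/
theorem tendsto_integral_mul_of_bounded_of_L1 {α : Type*} [MeasurableSpace α] {μ : Measure α}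
    {q F : ℕ → α → ℝ} {Q G : α → ℝ} {K : ℝ}
    (hqm : ∀ n, AEStronglyMeasurable (q n) μ) (hqK : ∀ n x, |q n x| ≤ K)
    (hq : ∀ᵐ x ∂μ, Tendsto (fun n => q n x) atTop (nhds (Q x)))
    (hF : ∀ n, Integrable (F n) μ) (hG : Integrable G μ)
    (hFG : Tendsto (fun n => ∫ x, |F n x - G x| ∂μ) atTop (nhds 0)) :
    Tendsto (fun n => ∫ x, q n x * F n x ∂μ) atTop (nhds (∫ x, Q x * G x ∂μ)) := by
  have hqb : ∀ n, ∀ᵐ x ∂μ, ‖q n x‖ ≤ K := fun n => ae_of_all _ fun x => hqK n x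
  have hsplit : ∀ n, ∫ x, q n x * F n x ∂μ
      = ∫ x, q n x * (F n x - G x) ∂μ + ∫ x, q n x * G x ∂μ := fun n => by
    refine Eq.trans ?_
      (integral_add (((hF n).sub hG).bdd_mul (hqm n) (hqb n)) (hG.bdd_mul (hqm n) (hqb n)))
    exact integral_congr_ae (ae_of_all _ fun x => by ring)
  have h1 : Tendsto (fun n => ∫ x, q n x * (F n x - G x) ∂μ) atTop (nhds 0) := by
    refine squeeze_zero_norm (fun n => ?_) (by simpa using hFG.const_mul K)
    rw [← integral_const_mul]
    refine norm_integral_le_of_norm_le (((hF n).sub hG).abs.const_mul K) (ae_of_all _ fun x => ?_)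
    rw [norm_mul]
    exact mul_le_mul_of_nonneg_right (hqK n x) (norm_nonneg _)
  have h2 : Tendsto (fun n => ∫ x, q n x * G x ∂μ) atTop (nhds (∫ x, Q x * G x ∂μ)) := by
    refine tendsto_integral_of_dominated_convergence (fun x => K * |G x|)
      (fun n => (hqm n).mul hG.1) (hG.abs.const_mul K) (fun n => ae_of_all _ fun x => ?_) ?_
    · rw [norm_mul]
      exact mul_le_mul_of_nonneg_right (hqK n x) (norm_nonneg _)
    · filter_upwards [hq] with x hx using hx.mul_const _
  simp only [hsplit]
  simpa using h1.add h2

/-- Difference quotients of a `C¹` function along two sequences converging to `x`. -/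
theorem tendsto_slope_of_continuous_deriv {f f' : ℝ → ℝ} (hf : ∀ x, HasDerivAt f (f' x) x)
    (hf' : Continuous f') {x : ℝ} {a b : ℕ → ℝ} (ha : Tendsto a atTop (nhds x))
    (hb : Tendsto b atTop (nhds x)) (hab : ∀ᶠ n in atTop, b n ≠ a n) :
    Tendsto (fun n => (f (b n) - f (a n)) / (b n - a n)) atTop (nhds (f' x)) := by
  have hs := hasStrictDerivAt_of_hasDerivAt_of_continuousAt (Eventually.of_forall hf)
    hf'.continuousAt (x := x)
  have ho : Tendsto (fun n => (f (b n) - f (a n) - (b n - a n) * f' x) / (b n - a n)) atTop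
      (nhds 0) := by
    simpa [Function.comp_def] using
      (hs.isLittleO.comp_tendsto (hb.prodMk_nhds ha)).tendsto_div_nhds_zero
  have ho' := ho.add_const (f' x)
  rw [zero_add] at ho'
  refine ho'.congr' ?_
  filter_upwards [hab] with n hn
  have := sub_ne_zero.2 hn
  field_simp
  ring

theorem abs_slope_le_of_abs_deriv_le {f f' : ℝ → ℝ} (hf : ∀ x, HasDerivAt f (f' x) x) {K : ℝ}
    (hK : ∀ x, |f' x| ≤ K) (a b : ℝ) : |(f b - f a) / (b - a)| ≤ K := by
  have h := convex_univ.norm_image_sub_le_of_norm_hasDerivWithin_le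
    (fun x _ => (hf x).hasDerivWithinAt) (fun x _ => hK x) (Set.mem_univ a) (Set.mem_univ b)
  rw [abs_div]
  exact div_le_of_le_mul₀ (abs_nonneg _) ((abs_nonneg _).trans (hK 0)) h

theorem exists_abs_le_of_periodic {f : ℝ → ℝ} (hf : Continuous f) (hp : f.Periodic 1) :
    ∃ K, ∀ x, |f x| ≤ K := by
  obtain ⟨K, hK⟩ := (hp.isBounded_of_continuous one_ne_zero hf).exists_norm_le
  exact ⟨K, fun x => hK _ ⟨x, rfl⟩⟩

theorem sum_Icc_one_eq_sum_range (f : ℤ → ℝ) (N : ℕ) :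
    ∑ j ∈ Finset.Icc (1 : ℤ) N, f j = ∑ i ∈ Finset.range N, f (i + 1) := by
  symm
  refine Finset.sum_bij (fun i _ => (i : ℤ) + 1) ?_ ?_ ?_ ?_
  · intro i hi
    simp only [Finset.mem_range, Finset.mem_Icc] at *
    omega
  · intro i _ j _ h
    omega
  · intro j hj
    simp only [Finset.mem_Icc] at hj
    exact ⟨(j - 1).toNat, by simp only [Finset.mem_range]; omega, by omega⟩
  · intro i _
    rfl

theorem sum_Icc_one_shift {N : ℕ} {f : ℤ → ℝ} (hf : ∀ j, f (j + N) = f j) :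
    ∑ j ∈ Finset.Icc (1 : ℤ) N, f (j + 1) = ∑ j ∈ Finset.Icc (1 : ℤ) N, f j := by
  rw [sum_Icc_one_eq_sum_range, sum_Icc_one_eq_sum_range]
  have h1 := Finset.sum_range_succ (fun i : ℕ => f ((i : ℤ) + 1)) N
  have h2 := Finset.sum_range_succ' (fun i : ℕ => f ((i : ℤ) + 1)) N
  have h3 := hf 1
  push_cast at h1 h2
  rw [add_comm (1 : ℤ)] at h3
  linarith

theorem measurable_step (a : ℤ → ℝ) (N : ℕ) : Measurable fun x : ℝ => a ⌈x * N⌉ :=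
  (measurable_from_top (f := a)).comp (Int.measurable_ceil.comp (measurable_id.mul_const _))

theorem integrable_step (a : ℤ → ℝ) (N : ℕ) :
    Integrable (fun x : ℝ => a ⌈x * N⌉) (volume.restrict (Set.Ioo (0 : ℝ) 1)) := by
  refine Integrable.of_bound (measurable_step a N).aestronglyMeasurable
    (∑ j ∈ Finset.Icc (0 : ℤ) N, |a j|) ?_
  filter_upwards [ae_restrict_mem measurableSet_Ioo] with x hx
  refine Finset.single_le_sum (f := fun j => |a j|) (fun j _ => abs_nonneg _) ?_
  rw [Finset.mem_Icc]
  refine ⟨Int.ceil_nonneg (mul_nonneg hx.1.le N.cast_nonneg), Int.ceil_le.2 ?_⟩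
  push_cast
  nlinarith [hx.2, (N.cast_nonneg : (0 : ℝ) ≤ N)]

/-- The integral of a step function on the uniform mesh of `(0, 1)`. -/
theorem integral_step (a : ℤ → ℝ) {N : ℕ} (hN : 0 < N) :
    ∫ x in Set.Ioo (0 : ℝ) 1, a ⌈x * N⌉ = ∑ j ∈ Finset.Icc (1 : ℤ) N, a j * (1 / N) := by
  have hN' : (0 : ℝ) < N := by exact_mod_cast hN
  have hcell : ∀ i : ℕ, ∀ x ∈ Set.Ioc ((i : ℝ) / N) (((i + 1 : ℕ) : ℝ) / N),
      a ⌈x * N⌉ = a (i + 1) := fun i x hx => by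
    congr 1
    rw [Int.ceil_eq_iff]
    have h1 := (div_lt_iff₀ hN').1 hx.1
    have h2 := (le_div_iff₀ hN').1 hx.2
    push_cast at *
    constructor <;> linarith
  have hle : ∀ i : ℕ, (i : ℝ) / N ≤ ((i + 1 : ℕ) : ℝ) / N := fun i => by
    gcongr; simp
  have hint : ∀ i : ℕ, IntervalIntegrable (fun x : ℝ => a ⌈x * N⌉) volume
      ((i : ℝ) / N) (((i + 1 : ℕ) : ℝ) / N) := fun i => by
    rw [intervalIntegrable_iff_integrableOn_Ioc_of_le (hle i)]
    exact (integrableOn_const (by simp)).congr_fun (fun x hx => (hcell i x hx).symm)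
      measurableSet_Ioc
  have hsum := intervalIntegral.sum_integral_adjacent_intervals (μ := volume)
    (f := fun x : ℝ => a ⌈x * N⌉) (a := fun i : ℕ => (i : ℝ) / N) (n := N) (fun i _ => hint i)
  rw [← integral_Ioc_eq_integral_Ioo, ← intervalIntegral.integral_of_le zero_le_one,
    sum_Icc_one_eq_sum_range]
  simp only [Nat.cast_zero, zero_div, div_self hN'.ne'] at hsum
  rw [← hsum]
  refine Finset.sum_congr rfl fun i _ => ?_
  rw [intervalIntegral.integral_of_le (hle i),
    setIntegral_congr_fun measurableSet_Ioc (hcell i)]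
  simp [← sub_div]
  ring_nf

theorem xj_sub (N : ℕ) (j : ℤ) : xj N j - xj N (j - 1) = 1 / N := by
  simp only [xj]; push_cast; ring

theorem tendsto_xj_ceil {Nn : ℕ → ℕ} (hNn : Tendsto Nn atTop atTop) (x : ℝ) :
    Tendsto (fun n => xj (Nn n) ⌈x * Nn n⌉) atTop (nhds x) := by
  have h := (tendsto_natCast_atTop_atTop (R := ℝ)).comp hNn
  have h0 : Tendsto (fun n => x + 1 / (Nn n : ℝ)) atTop (nhds x) := by
    simpa [Function.comp_def, Pi.inv_def] using h.inv_tendsto_atTop.const_add x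
  refine tendsto_of_tendsto_of_tendsto_of_le_of_le' tendsto_const_nhds h0 ?_ ?_ <;>
    filter_upwards [hNn.eventually_gt_atTop 0] with n hn
  all_goals
    have hn' : (0 : ℝ) < Nn n := by exact_mod_cast hn
    simp only [xj, mul_one_div]
  · rw [le_div_iff₀ hn']
    exact Int.le_ceil _
  · rw [div_le_iff₀ hn', add_mul, one_div_mul_cancel hn'.ne']
    exact (Int.ceil_lt_add_one _).le

theorem tendsto_xj_ceil_sub_one {Nn : ℕ → ℕ} (hNn : Tendsto Nn atTop atTop) (x : ℝ) :
    Tendsto (fun n => xj (Nn n) (⌈x * Nn n⌉ - 1)) atTop (nhds x) := by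
  have h := (tendsto_natCast_atTop_atTop (R := ℝ)).comp hNn
  have h0 : Tendsto (fun n => 1 / (Nn n : ℝ)) atTop (nhds 0) := by
    simpa [Function.comp_def, Pi.inv_def] using h.inv_tendsto_atTop
  have h1 := (tendsto_xj_ceil hNn x).sub h0
  rw [sub_zero] at h1
  refine h1.congr fun n => ?_
  have := xj_sub (Nn n) ⌈x * Nn n⌉
  linarith

/-- The turning angle between two consecutive segments as a difference of inclinations. -/
theorem θq_eq (N : ℕ) (v : ℤ → ℝ) (j : ℤ) :
    θq N v j = |Real.arctan (dq N v (j + 1)) - Real.arctan (dq N v j)| := by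
  set a := dq N v j
  set b := dq N v (j + 1)
  have h : (1 + a * b) / (Real.sqrt (1 + a ^ 2) * Real.sqrt (1 + b ^ 2))
      = Real.cos |Real.arctan b - Real.arctan a| := by
    rw [Real.cos_abs, Real.cos_sub, Real.cos_arctan, Real.cos_arctan, Real.sin_arctan,
      Real.sin_arctan]
    field_simp
  simp only [θq]
  rw [h, Real.arccos_cos (abs_nonneg _)]
  have := Real.arctan_lt_pi_div_two a
  have := Real.arctan_lt_pi_div_two b
  have := Real.neg_pi_div_two_lt_arctan a
  have := Real.neg_pi_div_two_lt_arctan b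
  rw [abs_le]
  constructor <;> linarith

theorem sub_le_sq_mul_weight {a b : ℝ} (ha : 0 < a) (hb : 0 < b) (t p : ℝ) :
    2 * p * t - p ^ 2 * (a + b) ≤ t ^ 2 * ((a ^ 3 + b ^ 3) / (a * b * (a + b) ^ 2)) := by
  have h1 : 1 / (a + b) ≤ (a ^ 3 + b ^ 3) / (a * b * (a + b) ^ 2) := by
    rw [div_le_div_iff₀ (by positivity) (by positivity)]
    nlinarith [mul_nonneg (sq_nonneg (a - b)) (pow_pos (add_pos ha hb) 2).le]
  refine le_trans ?_ (mul_le_mul_of_nonneg_left h1 (sq_nonneg t))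
  rw [mul_one_div, le_div_iff₀ (by positivity)]
  nlinarith [sq_nonneg (t - p * (a + b))]

theorem dq_periodic {N : ℕ} {v : ℤ → ℝ} (hv : ∀ j, v (j + N) = v j) (j : ℤ) :
    dq N v (j + N) = dq N v j := by
  simp only [dq]
  rw [hv, show j + (N : ℤ) - 1 = j - 1 + N by ring, hv]

/-- Dual lower bound of the discrete bending energy by a linear-quadratic functional of the
inclinations, tested with a periodic function `p`. -/
theorem integral_le_energy {N : ℕ} (hN : 0 < N) {v : ℤ → ℝ} (hv : ∀ j, v (j + N) = v j)
    {p : ℝ → ℝ} (hp : p.Periodic 1) :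
    (∫ x in Set.Ioo (0 : ℝ) 1,
        (-2) * ((p (xj N ⌈x * N⌉) - p (xj N (⌈x * N⌉ - 1))) / (1 / N)
          * Real.arctan (slopeFn N v x))
        - (p (xj N ⌈x * N⌉) ^ 2 + p (xj N (⌈x * N⌉ - 1)) ^ 2) / 2
          * Real.sqrt (1 + slopeFn N v x ^ 2)) ≤
      ∑ j ∈ Finset.Icc (1 : ℤ) N, θq N v j ^ 2 *
        ((lq N v j ^ 3 + lq N v (j + 1) ^ 3) /
          (lq N v j * lq N v (j + 1) * (lq N v j + lq N v (j + 1)) ^ 2)) := by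
  have hN' : (0 : ℝ) < N := by exact_mod_cast hN
  have hl : ∀ j, 0 < lq N v j := fun j => by
    simp only [lq]; positivity
  have hpj : ∀ j : ℤ, p (xj N (j + N)) = p (xj N j) := fun j => by
    rw [← hp (xj N j)]
    congr 1
    simp only [xj]; push_cast; field_simp
  have hd := dq_periodic hv
  refine le_trans (le_of_eq ?_) (Finset.sum_le_sum (f := fun j =>
    2 * p (xj N j) * (Real.arctan (dq N v (j + 1)) - Real.arctan (dq N v j))
      - p (xj N j) ^ 2 * (lq N v j + lq N v (j + 1))) fun j _ => ?_)
  · simp only [slopeFn]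
    rw [integral_step (fun j => (-2) * ((p (xj N j) - p (xj N (j - 1))) / (1 / N)
          * Real.arctan (dq N v j))
        - (p (xj N j) ^ 2 + p (xj N (j - 1)) ^ 2) / 2
          * Real.sqrt (1 + dq N v j ^ 2)) hN]
    have hshift := sum_Icc_one_shift (N := N)
      (f := fun j => 2 * p (xj N (j - 1)) * Real.arctan (dq N v j)
        - p (xj N (j - 1)) ^ 2 * lq N v j) (fun j => by
          simp only [lq, hd]
          rw [show j + (N : ℤ) - 1 = j - 1 + N by ring, hpj])
    simp only [add_sub_cancel_right] at hshift
    rw [← sub_eq_zero, ← Finset.sum_sub_distrib] at hshift ⊢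
    rw [← neg_eq_zero, ← Finset.sum_neg_distrib] at hshift
    rw [← hshift]
    refine Finset.sum_congr rfl fun j _ => ?_
    simp only [lq]
    field_simp
    ring
  · rw [θq_eq, sq_abs]
    exact sub_le_sq_mul_weight (hl _) (hl _) _ _

theorem integrable_Ioo_of_continuous {f : ℝ → ℝ} (hf : Continuous f) :
    Integrable f (volume.restrict (Set.Ioo (0 : ℝ) 1)) :=
  (hf.integrableOn_Icc (a := 0) (b := 1)).mono_set Set.Ioo_subset_Icc_self

/-- Convergence of the slopes in `L²` passes to `L¹` convergence of `1`-Lipschitz images. -/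
theorem tendsto_integral_abs_lipschitz_slopeFn {Nn : ℕ → ℕ} {vn : ℕ → ℤ → ℝ} {u : ℝ → ℝ}
    (hu : Continuous u) (hup : u.Periodic 1)
    (hL : Tendsto (fun n => ∫ x in Set.Ioo (0 : ℝ) 1, (slopeFn (Nn n) (vn n) x - u x) ^ 2)
      atTop (nhds 0)) {φ : ℝ → ℝ} (hφ : Continuous φ) (hφ1 : ∀ a b, |φ a - φ b| ≤ |a - b|) :
    Tendsto (fun n => ∫ x in Set.Ioo (0 : ℝ) 1, |φ (slopeFn (Nn n) (vn n) x) - φ (u x)|)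
      atTop (nhds 0) := by
  obtain ⟨K, hK⟩ := exists_abs_le_of_periodic hu hup
  have hs : Tendsto (fun n => Real.sqrt
      (∫ x in Set.Ioo (0 : ℝ) 1, (slopeFn (Nn n) (vn n) x - u x) ^ 2)) atTop (nhds 0) := by
    simpa using hL.sqrt
  refine squeeze_zero (fun n => integral_nonneg fun x => abs_nonneg _) (fun n => ?_) hs
  have hstep := integrable_step (dq (Nn n) (vn n)) (Nn n)
  have hui := integrable_Ioo_of_continuous hu
  have hF : Integrable (fun x => slopeFn (Nn n) (vn n) x - u x)
      (volume.restrict (Set.Ioo (0 : ℝ) 1)) := hstep.sub hui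
  have hF2 : Integrable (fun x => (slopeFn (Nn n) (vn n) x - u x) ^ 2)
      (volume.restrict (Set.Ioo (0 : ℝ) 1)) := by
    have h1 := integrable_step (fun j => dq (Nn n) (vn n) j ^ 2) (Nn n)
    have h2 := (hstep.bdd_mul hui.1 (c := K) (ae_of_all _ hK)).const_mul 2
    have h3 := integrable_Ioo_of_continuous (hu.pow 2)
    refine ((h1.sub h2).add h3).congr (ae_of_all _ fun x => ?_)
    simp only [slopeFn, Pi.add_apply, Pi.sub_apply, Pi.pow_apply]
    ring
  have hφi : Integrable (fun x => φ (slopeFn (Nn n) (vn n) x) - φ (u x))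
      (volume.restrict (Set.Ioo (0 : ℝ) 1)) :=
    (integrable_step (fun j => φ (dq (Nn n) (vn n) j)) (Nn n)).sub
      (integrable_Ioo_of_continuous (hφ.comp hu))
  refine (integral_mono hφi.abs hF.abs fun x => hφ1 _ _).trans ?_
  refine Real.le_sqrt_of_sq_le ?_
  set A := ∫ x in Set.Ioo (0 : ℝ) 1, |slopeFn (Nn n) (vn n) x - u x| with hA
  have hle : ∫ x in Set.Ioo (0 : ℝ) 1, 2 * A * |slopeFn (Nn n) (vn n) x - u x| ≤
      ∫ x in Set.Ioo (0 : ℝ) 1, (A ^ 2 + (slopeFn (Nn n) (vn n) x - u x) ^ 2) := by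
    refine integral_mono (hF.abs.const_mul _) ((integrable_const _).add hF2) fun x => ?_
    simp only
    nlinarith [sq_nonneg (A - |slopeFn (Nn n) (vn n) x - u x|),
      sq_abs (slopeFn (Nn n) (vn n) x - u x)]
  rw [integral_const_mul, ← hA, integral_add (integrable_const _) hF2] at hle
  simp at hle
  nlinarith

theorem abs_arctan_sub_arctan_le (a b : ℝ) : |Real.arctan a - Real.arctan b| ≤ |a - b| := by
  have h := convex_univ.norm_image_sub_le_of_norm_hasDerivWithin_le (C := 1)
    (fun x _ => (Real.hasDerivAt_arctan x).hasDerivWithinAt) (fun x _ => ?_)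
    (Set.mem_univ b) (Set.mem_univ a)
  · simpa using h
  · rw [Real.norm_of_nonneg (by positivity), div_le_one (by positivity)]
    nlinarith [sq_nonneg x]

theorem abs_sqrt_one_add_sq_sub_le (a b : ℝ) :
    |Real.sqrt (1 + a ^ 2) - Real.sqrt (1 + b ^ 2)| ≤ |a - b| := by
  refine sq_le_sq.1 ?_
  rw [ sub_sq, Real.sq_sqrt (by positivity), Real.sq_sqrt (by positivity)]
  have h : 1 + a * b ≤ Real.sqrt (1 + a ^ 2) * Real.sqrt (1 + b ^ 2) := by
    rw [← Real.sqrt_mul (by positivity)]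
    refine Real.le_sqrt_of_sq_le ?_
    nlinarith [sq_nonneg (a - b)]
  nlinarith

/-- The lower bound of the liminf by the dual functional evaluated at a `C¹` periodic `p`. -/
theorem dual_le_liminf_energy {u u' p p' : ℝ → ℝ} (hu : ∀ x, HasDerivAt u (u' x) x)
    (hu' : Continuous u') (hup : u.Periodic 1)
    (hp : ∀ x, HasDerivAt p (p' x) x) (hp' : Continuous p') (hpp : p.Periodic 1)
    {Nn : ℕ → ℕ} (hNn : Tendsto Nn atTop atTop)
    {vn : ℕ → ℤ → ℝ} (hvn : ∀ n j, vn n (j + Nn n) = vn n j)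
    (hL : Tendsto (fun n => ∫ x in Set.Ioo (0 : ℝ) 1, (slopeFn (Nn n) (vn n) x - u x) ^ 2)
      atTop (nhds 0)) :
    ((∫ x in Set.Ioo (0 : ℝ) 1, (2 * (p x * (u' x / (1 + u x ^ 2)))
        - p x ^ 2 * Real.sqrt (1 + u x ^ 2)) : ℝ) : EReal) ≤
      liminf (fun n =>
        ((∑ j ∈ Finset.Icc (1 : ℤ) (Nn n : ℤ),
          θq (Nn n) (vn n) j ^ 2 *
            ((lq (Nn n) (vn n) j ^ 3 + lq (Nn n) (vn n) (j + 1) ^ 3) /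
              (lq (Nn n) (vn n) j * lq (Nn n) (vn n) (j + 1) *
                (lq (Nn n) (vn n) j + lq (Nn n) (vn n) (j + 1)) ^ 2)) : ℝ) : EReal))
        atTop := by
  have huc : Continuous u := continuous_iff_continuousAt.2 fun x => (hu x).continuousAt
  have hpc : Continuous p := continuous_iff_continuousAt.2 fun x => (hp x).continuousAt
  have hsc : Continuous fun a : ℝ => Real.sqrt (1 + a ^ 2) := by fun_prop
  have hp'p : p'.Periodic 1 := fun x => by
    have h1 := (hp (x + 1)).comp_add_const x 1
    rw [show (fun y => p (y + 1)) = p from funext hpp] at h1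
    exact h1.unique (hp x)
  obtain ⟨K, hK⟩ := exists_abs_le_of_periodic hp' hp'p
  obtain ⟨M, hM⟩ := exists_abs_le_of_periodic (hpc.pow 2) fun x => by simp [hpp x]
  have harc := tendsto_integral_mul_of_bounded_of_L1 (μ := volume.restrict (Set.Ioo (0 : ℝ) 1))
    (q := fun n x => (p (xj (Nn n) ⌈x * Nn n⌉) - p (xj (Nn n) (⌈x * Nn n⌉ - 1))) / (1 / Nn n))
    (Q := p') (K := K) (F := fun n x => Real.arctan (slopeFn (Nn n) (vn n) x))
    (fun n => (measurable_step (fun j => (p (xj (Nn n) j) - p (xj (Nn n) (j - 1))) / (1 / Nn n))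
      (Nn n)).aestronglyMeasurable)
    (fun n x => by
      rw [← xj_sub (Nn n) ⌈x * Nn n⌉]
      exact abs_slope_le_of_abs_deriv_le hp hK _ _)
    (ae_of_all _ fun x => by
      have h := tendsto_slope_of_continuous_deriv hp hp' (tendsto_xj_ceil_sub_one hNn x)
        (tendsto_xj_ceil hNn x) (by
          filter_upwards [hNn.eventually_gt_atTop 0] with n hn
          have hn' : (0 : ℝ) < Nn n := by exact_mod_cast hn
          rw [← sub_ne_zero, xj_sub]
          positivity)
      simpa only [xj_sub] using h)
    (fun n => integrable_step (fun j => Real.arctan (dq (Nn n) (vn n) j)) (Nn n))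
    (integrable_Ioo_of_continuous (Real.continuous_arctan.comp huc))
    (tendsto_integral_abs_lipschitz_slopeFn huc hup hL Real.continuous_arctan
      abs_arctan_sub_arctan_le)
  have hsqrt := tendsto_integral_mul_of_bounded_of_L1 (μ := volume.restrict (Set.Ioo (0 : ℝ) 1))
    (q := fun n x => (p (xj (Nn n) ⌈x * Nn n⌉) ^ 2 + p (xj (Nn n) (⌈x * Nn n⌉ - 1)) ^ 2) / 2)
    (Q := fun x => p x ^ 2) (K := M)
    (F := fun n x => Real.sqrt (1 + slopeFn (Nn n) (vn n) x ^ 2))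
    (fun n => (measurable_step (fun j => (p (xj (Nn n) j) ^ 2 + p (xj (Nn n) (j - 1)) ^ 2) / 2)
      (Nn n)).aestronglyMeasurable)
    (fun n x => by
      have h1 := (abs_le.1 (hM (xj (Nn n) ⌈x * Nn n⌉)))
      have h2 := (abs_le.1 (hM (xj (Nn n) (⌈x * Nn n⌉ - 1))))
      simp only [Pi.pow_apply] at h1 h2
      rw [abs_le]
      constructor <;> linarith [h1.1, h1.2, h2.1, h2.2])
    (ae_of_all _ fun x => by
      have h1 := ((hpc.pow 2).tendsto x).comp (tendsto_xj_ceil hNn x)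
      have h2 := ((hpc.pow 2).tendsto x).comp (tendsto_xj_ceil_sub_one hNn x)
      simpa using (h1.add h2).div_const 2)
    (fun n => integrable_step (fun j => Real.sqrt (1 + dq (Nn n) (vn n) j ^ 2)) (Nn n))
    (integrable_Ioo_of_continuous (hsc.comp huc))
    (tendsto_integral_abs_lipschitz_slopeFn huc hup hL hsc abs_sqrt_one_add_sq_sub_le)
  have hdc : Continuous fun x => u' x / (1 + u x ^ 2) :=
    hu'.div (by fun_prop) fun x => by positivity
  have hparts : ∫ x in Set.Ioo (0 : ℝ) 1, p' x * Real.arctan (u x)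
      = -∫ x in Set.Ioo (0 : ℝ) 1, p x * (u' x / (1 + u x ^ 2)) := by
    have hd : ∀ x, HasDerivAt (fun x => Real.arctan (u x)) (u' x / (1 + u x ^ 2)) x := fun x => by
      simpa [div_eq_inv_mul] using (hu x).arctan
    have h := intervalIntegral.integral_deriv_mul_eq_sub (a := 0) (b := 1)
      (fun x _ => hp x) (fun x _ => hd x) (hp'.intervalIntegrable _ _) (hdc.intervalIntegrable _ _)
    have hp01 : p 1 = p 0 := by simpa using hpp 0
    have hu01 : u 1 = u 0 := by simpa using hup 0
    have hi1 : Integrable (fun x => p' x * Real.arctan (u x))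
        (volume.restrict (Set.Ioo (0 : ℝ) 1)) :=
      integrable_Ioo_of_continuous (hp'.mul (Real.continuous_arctan.comp huc))
    have hi2 : Integrable (fun x => p x * (u' x / (1 + u x ^ 2)))
        (volume.restrict (Set.Ioo (0 : ℝ) 1)) := integrable_Ioo_of_continuous (hpc.mul hdc)
    rw [hp01, hu01, sub_self, intervalIntegral.integral_of_le zero_le_one,
      integral_Ioc_eq_integral_Ioo, integral_add hi1 hi2] at h
    linarith
  have hlim := (harc.const_mul (-2)).sub hsqrt
  simp only [Function.comp_apply] at hlim
  have hi1 : Integrable (fun x => 2 * (p x * (u' x / (1 + u x ^ 2))))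
      (volume.restrict (Set.Ioo (0 : ℝ) 1)) :=
    integrable_Ioo_of_continuous (continuous_const.mul (hpc.mul hdc))
  have hi2 : Integrable (fun x => p x ^ 2 * Real.sqrt (1 + u x ^ 2))
      (volume.restrict (Set.Ioo (0 : ℝ) 1)) :=
    integrable_Ioo_of_continuous ((hpc.pow 2).mul (hsc.comp huc))
  rw [hparts, mul_neg, neg_mul, neg_neg, ← integral_const_mul, ← integral_sub hi1 hi2] at hlim
  have hE := (continuous_coe_real_ereal.tendsto _).comp hlim
  refine hE.liminf_eq.ge.trans (liminf_le_liminf ?_)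
  filter_upwards [hNn.eventually_gt_atTop 0] with n hn
  refine EReal.coe_le_coe_iff.2 (le_trans (le_of_eq ?_) (integral_le_energy hn (hvn n) hpp))
  beta_reduce
  rw [← integral_const_mul, ← integral_sub]
  · exact (integrable_step (fun j =>
      (p (xj (Nn n) j) - p (xj (Nn n) (j - 1))) / (1 / Nn n)
        * Real.arctan (dq (Nn n) (vn n) j)) (Nn n)).const_mul (-2)
  · exact integrable_step (fun j => (p (xj (Nn n) j) ^ 2 + p (xj (Nn n) (j - 1)) ^ 2) / 2
      * Real.sqrt (1 + dq (Nn n) (vn n) j ^ 2)) (Nn n)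

theorem hasDerivAt_div_sqrt_one_add_sq {u : ℝ → ℝ} {u' x : ℝ} (hu : HasDerivAt u u' x) :
    HasDerivAt (fun x => u x / Real.sqrt (1 + u x ^ 2)) (u' / Real.sqrt (1 + u x ^ 2) ^ 3) x := by
  have hpos : 0 < Real.sqrt (1 + u x ^ 2) := by positivity
  have hs : Real.sqrt (1 + u x ^ 2) ^ 2 = 1 + u x ^ 2 := Real.sq_sqrt (by positivity)
  have hne : 1 + u x ^ 2 ≠ 0 := by positivity
  have h := hu.div (((hu.pow 2).const_add 1).sqrt hne) hpos.ne'
  refine h.congr_deriv ?_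
  simp only [Pi.pow_apply, Nat.cast_ofNat]
  field_simp
  rw [hs]
  ring

/-- Liminf inequality for the discrete bending energy along H¹-convergent polygons. -/
theorem stmt12 (v : ℝ → ℝ) (hv : ContDiff ℝ 2 v) (hper : ∀ x, v (x + 1) = v x)
    (Nn : ℕ → ℕ) (hNn : Tendsto Nn atTop atTop)
    (vn : ℕ → ℤ → ℝ) (hvnper : ∀ n j, vn n (j + Nn n) = vn n j)
    (hL2 : Tendsto (fun n => ∫ x in Set.Ioo (0 : ℝ) 1, (interp (Nn n) (vn n) x - v x) ^ 2)
      atTop (nhds 0))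
    (hL2' : Tendsto
      (fun n => ∫ x in Set.Ioo (0 : ℝ) 1, (slopeFn (Nn n) (vn n) x - deriv v x) ^ 2)
      atTop (nhds 0)) :
    ((∫ x in Set.Ioo (0 : ℝ) 1,
        deriv (deriv v) x ^ 2 / (1 + deriv v x ^ 2) ^ ((5 : ℝ) / 2) : ℝ) : EReal) ≤
      liminf (fun n =>
        ((∑ j ∈ Finset.Icc (1 : ℤ) (Nn n : ℤ),
          θq (Nn n) (vn n) j ^ 2 *
            ((lq (Nn n) (vn n) j ^ 3 + lq (Nn n) (vn n) (j + 1) ^ 3) /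
              (lq (Nn n) (vn n) j * lq (Nn n) (vn n) (j + 1) *
                (lq (Nn n) (vn n) j + lq (Nn n) (vn n) (j + 1)) ^ 2)) : ℝ) : EReal))
        atTop := by
  have hu1 : ContDiff ℝ 1 (deriv v) := (contDiff_succ_iff_deriv (n := 1).1 hv).2.2
  have hu : ∀ x, HasDerivAt (deriv v) (deriv (deriv v) x) x := fun x =>
    (hu1.differentiable one_ne_zero x).hasDerivAt
  have hu' : Continuous (deriv (deriv v)) := hu1.continuous_deriv le_rfl
  have hup : (deriv v).Periodic 1 := fun x => by
    rw [← deriv_comp_add_const, funext hper]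
  have hu'p : (deriv (deriv v)).Periodic 1 := fun x => by
    rw [← deriv_comp_add_const, funext hup]
  clear hL2
  generalize deriv (deriv v) = u' at *
  generalize deriv v = u at *
  have huc : Continuous u := hu1.continuous
  set s : ℝ → ℝ := fun x => Real.sqrt (1 + u x ^ 2) with hs
  have hsc : Continuous s := by fun_prop
  have hspos : ∀ x, 0 < s x := fun x => by simp only [hs]; positivity
  set g : ℝ → ℝ := fun x => u' x / s x ^ 3 with hg
  set G : ℝ → ℝ := fun x => u x / s x with hGdef
  have hgc : Continuous g := hu'.div (hsc.pow 3) fun x => (pow_pos (hspos x) 3).ne'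
  have hG : ∀ x, HasDerivAt G (g x) x := fun x => hasDerivAt_div_sqrt_one_add_sq (hu x)
  have hGp : G.Periodic 1 := fun x => by simp only [hGdef, hs, hup x]
  have hgp : g.Periodic 1 := fun x => by simp only [hg, hs, hup x, hu'p x]
  obtain ⟨K, hK⟩ := exists_abs_le_of_periodic hgc hgp
  set p : ℕ → ℝ → ℝ := fun k x => (G (x + 1 / (k + 1)) - G x) / (1 / (k + 1)) with hpdef
  have hpd : ∀ k x, HasDerivAt (p k) ((g (x + 1 / (k + 1)) - g x) / (1 / (k + 1))) x :=
    fun k x => (((hG _).comp_add_const x _).sub (hG x)).div_const _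
  have hpd' : ∀ k : ℕ, Continuous fun x => (g (x + 1 / (k + 1)) - g x) / (1 / (k + 1)) :=
    fun k => by fun_prop
  have hpc : ∀ k, Continuous (p k) := fun k =>
    continuous_iff_continuousAt.2 fun x => (hpd k x).continuousAt
  have hpp : ∀ k, (p k).Periodic 1 := fun k x => by
    simp only [hpdef]
    rw [add_right_comm, hGp, hGp]
  have hpK : ∀ k x, |p k x| ≤ K := fun k x => by
    have h := abs_slope_le_of_abs_deriv_le hG hK x (x + 1 / (k + 1))
    rwa [add_sub_cancel_left] at h
  have hpg : ∀ x, Tendsto (fun k => p k x) atTop (nhds (g x)) := fun x => by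
    have hlim : Tendsto (fun k : ℕ => x + 1 / ((k : ℝ) + 1)) atTop (nhds x) := by
      simpa using (tendsto_one_div_add_atTop_nhds_zero_nat (𝕜 := ℝ)).const_add x
    have h := tendsto_slope_of_continuous_deriv hG hgc tendsto_const_nhds hlim
      (Eventually.of_forall fun k => by
        have : (0 : ℝ) < 1 / ((k : ℝ) + 1) := by positivity
        exact (lt_add_of_pos_right x this).ne')
    simpa only [add_sub_cancel_left] using h
  have hle := fun k => dual_le_liminf_energy hu hu' hup (hpd k) (hpd' k) (hpp k) hNn hvnper hL2'
  refine le_of_tendsto' (x := (atTop : Filter ℕ)) ((continuous_coe_real_ereal.tendsto _).comp ?_) hle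
  have hdc : Continuous fun x => u' x / (1 + u x ^ 2) :=
    hu'.div (by fun_prop) fun x => by positivity
  refine tendsto_integral_of_dominated_convergence
    (fun x => 2 * (K * |u' x / (1 + u x ^ 2)|) + K ^ 2 * s x) (fun k => ?_)
    (integrable_Ioo_of_continuous (by fun_prop)) (fun k => ae_of_all _ fun x => ?_)
    (ae_of_all _ fun x => ?_)
  · exact (integrable_Ioo_of_continuous ((continuous_const.mul ((hpc k).mul hdc)).sub
      (((hpc k).pow 2).mul hsc))).1
  · refine (norm_sub_le _ _).trans (add_le_add ?_ ?_)
    · rw [norm_mul, norm_mul, Real.norm_two]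
      exact mul_le_mul_of_nonneg_left
        (mul_le_mul_of_nonneg_right (hpK k x) (norm_nonneg _)) zero_le_two
    · rw [norm_mul, norm_pow, Real.norm_of_nonneg (hspos x).le]
      exact mul_le_mul_of_nonneg_right
        (pow_le_pow_left₀ (norm_nonneg _) (hpK k x) 2) (hspos x).le
  · have hval : u' x ^ 2 / (1 + u x ^ 2) ^ ((5 : ℝ) / 2)
        = 2 * (g x * (u' x / (1 + u x ^ 2))) - g x ^ 2 * s x := by
      have h2 : 1 + u x ^ 2 = s x ^ 2 := (Real.sq_sqrt (by positivity)).symm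
      have h5 : (s x ^ 2) ^ ((5 : ℝ) / 2) = s x ^ 5 := by
        rw [← Real.rpow_natCast, ← Real.rpow_mul (hspos x).le, ← Real.rpow_natCast]
        norm_num
      have := hspos x
      rw [h2, h5]
      simp only [hg]
      field_simp
      ring
    rw [hval]
    exact (((hpg x).mul_const _).const_mul 2).sub (((hpg x).pow 2).mul_const _)

end
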